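/- For all nonempty permutations α and γ, the classes Av(α⊖1), Av(1⊖γ), and Av(α⊖1⊖γ) possess finite proper growth rates, and gr(Av(α⊖1⊖γ)) = (√gr(Av(α⊖1)) + √gr(Av(1⊖γ)))². -/

import Mathlib

open Filter Topology ENNReal

/-- A permutation of length `n`, in one-line notation `π 0, π 1, …, π (n-1)`. -/
abbrev Perm (n : ℕ) := Equiv.Perm (Fin n)

/-- `Pattern σ π` : the permutation `σ` is contained in `π`, i.e. some subsequence of `π`
is order isomorphic to `σ`. -/
def Pattern {k n : ℕ} (σ : Perm k) (π : Perm n) : Prop :=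
  ∃ f : Fin k ↪o Fin n, ∀ i j : Fin k, σ i < σ j ↔ π (f i) < π (f j)

/-- A permutation class: a set of permutations closed downwards under containment. -/
structure PermClass where
  mem : ∀ n, Set (Perm n)
  closed : ∀ {k n : ℕ} (σ : Perm k) (π : Perm n), π ∈ mem n → Pattern σ π → σ ∈ mem k

/-- The entries of `π` at the positions in `A` form a sequence order isomorphic
to a member of the family `F`. -/
def SubpermIn {n : ℕ} (π : Perm n) (A : Set (Fin n)) (F : ∀ m, Set (Perm m)) : Prop :=
  ∃ (m : ℕ) (σ : Perm m) (f : Fin m ↪o Fin n),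
    Set.range ⇑f = A ∧ (∀ i j : Fin m, σ i < σ j ↔ π (f i) < π (f j)) ∧ σ ∈ F m

/-- The merge `C ⊙ D`: permutations whose entries can be partitioned into a subsequence
order isomorphic to a member of `C` and one order isomorphic to a member of `D`. -/
def mergeSet (C D : ∀ m, Set (Perm m)) (n : ℕ) : Set (Perm n) :=
  {π | ∃ A : Set (Fin n), SubpermIn π A C ∧ SubpermIn π Aᶜ D}

/-- `|F_n| ^ (1/n)` as a real number. -/
noncomputable def growthSeq (F : ∀ m, Set (Perm m)) (n : ℕ) : ℝ :=
  ((F n).ncard : ℝ) ^ ((n : ℝ)⁻¹)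

/-- The family `F` has (finite) proper growth rate `g`. -/
def HasGrowth (F : ∀ m, Set (Perm m)) (g : ℝ) : Prop :=
  Tendsto (growthSeq F) atTop (𝓝 g)

/-- `|F_n| ^ (1/n)` in the extended nonnegative reals. -/
noncomputable def eGrowthSeq (F : ∀ m, Set (Perm m)) (n : ℕ) : ℝ≥0∞ :=
  ((F n).ncard : ℝ≥0∞) ^ ((n : ℝ)⁻¹)

/-- The upper growth rate `limsup |F_n|^(1/n)`. -/
noncomputable def ugr (F : ∀ m, Set (Perm m)) : ℝ≥0∞ := limsup (eGrowthSeq F) atTop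

/-- The lower growth rate `liminf |F_n|^(1/n)`. -/
noncomputable def lgr (F : ∀ m, Set (Perm m)) : ℝ≥0∞ := liminf (eGrowthSeq F) atTop

/-- The direct sum `π ⊕ σ` of two permutations. -/
def dsum {m n : ℕ} (π : Perm m) (σ : Perm n) : Perm (m + n) :=
  finSumFinEquiv.symm.trans ((Equiv.sumCongr π σ).trans finSumFinEquiv)

/-- The skew sum `π ⊖ σ` of two permutations. -/
def skewSum {m n : ℕ} (π : Perm m) (σ : Perm n) : Perm (m + n) :=
  finSumFinEquiv.symm.trans ((Equiv.sumCongr π σ).trans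
    (((Equiv.sumComm (Fin m) (Fin n)).trans finSumFinEquiv).trans (finCongr (Nat.add_comm n m))))

/-- A family of permutations is sum closed if it is closed under `⊕`. -/
def SumClosed (F : ∀ m, Set (Perm m)) : Prop :=
  ∀ {m n : ℕ} (π : Perm m) (σ : Perm n), π ∈ F m → σ ∈ F n → dsum π σ ∈ F (m + n)

/-- A family of permutations is skew closed if it is closed under `⊖`. -/
def SkewClosed (F : ∀ m, Set (Perm m)) : Prop :=
  ∀ {m n : ℕ} (π : Perm m) (σ : Perm n), π ∈ F m → σ ∈ F n → skewSum π σ ∈ F (m + n)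

/-- The class of an empty (blocked) grid cell: only the empty permutation. -/
def emptyCell : ∀ m, Set (Perm m) := fun m => {_π | m = 0}

/-- The set of positions of `π` lying in column `k` and row `ℓ` of the gridding
determined by the column divisions `c` and row divisions `r`. -/
def cellSet {n : ℕ} (π : Perm n) (c r : ℕ → ℕ) (k ℓ : ℕ) : Set (Fin n) :=
  {i | c k ≤ (i : ℕ) ∧ (i : ℕ) < c (k + 1) ∧ r ℓ ≤ (π i : ℕ) ∧ (π i : ℕ) < r (ℓ + 1)}

/-- The grid class of an (infinite) matrix `M` of families of permutations, where
`M k ℓ` is the cell in column `k`, row `ℓ` (Cartesian coordinates, indexed from 0). -/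
def gridSet (M : ℕ → ℕ → ∀ m, Set (Perm m)) (n : ℕ) : Set (Perm n) :=
  {π | ∃ c r : ℕ → ℕ, Monotone c ∧ Monotone r ∧ c 0 = 0 ∧ r 0 = 0 ∧
    (∀ k, c k ≤ n) ∧ (∀ ℓ, r ℓ ≤ n) ∧ (∃ k, c k = n) ∧ (∃ ℓ, r ℓ = n) ∧
    ∀ k ℓ, cellSet π c r k ℓ = ∅ ∨ SubpermIn π (cellSet π c r k ℓ) (M k ℓ)}

/-- The matrix of the infinite increasing `(C, D)` staircase: cell in column `i`, row `i`
is `C`, cell in column `i+1`, row `i` is `D`, all other cells empty. -/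
def incStairM (C D : ∀ m, Set (Perm m)) : ℕ → ℕ → ∀ m, Set (Perm m) :=
  fun k ℓ => if k = ℓ then C else if k = ℓ + 1 then D else emptyCell

/-- The decreasing permutation `k (k-1) ⋯ 2 1` of length `k`. -/
def delta (k : ℕ) : Perm k := ⟨Fin.rev, Fin.rev, Fin.rev_rev, Fin.rev_rev⟩

/-- The class of permutations avoiding the pattern `τ`. -/
def avSet {k : ℕ} (τ : Perm k) : ∀ n, Set (Perm n) := fun n => {π | ¬ Pattern τ π}

/-- The shape of an infinite `(C,D)` staircase: `pos j` is the (column, row) position of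
the `(j+1)`-st cell; odd-indexed steps share a row with their predecessor, even-indexed
steps share a column with their predecessor, and no other sharing of rows or columns occurs. -/
structure StaircaseData where
  pos : ℕ → ℕ × ℕ
  inj : Function.Injective pos
  rowEq : ∀ i, (pos (2 * i + 1)).2 = (pos (2 * i)).2
  colEq : ∀ i, (pos (2 * i + 2)).1 = (pos (2 * i + 1)).1
  rowOnly : ∀ j j', (pos j).2 = (pos j').2 → j / 2 = j' / 2
  colOnly : ∀ j j', (pos j).1 = (pos j').1 → (j + 1) / 2 = (j' + 1) / 2

open Classical in
/-- The matrix of the infinite `(C,D)` staircase with shape `S`: the odd-numbered cells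
(cells `1, 3, 5, …`, i.e. `pos 0, pos 2, …`) are `C`, the even-numbered cells are `D`. -/
noncomputable def StaircaseData.M (S : StaircaseData) (C D : ∀ m, Set (Perm m)) :
    ℕ → ℕ → ∀ m, Set (Perm m) :=
  fun k ℓ => if ∃ i, S.pos (2 * i) = (k, ℓ) then C
    else if ∃ i, S.pos (2 * i + 1) = (k, ℓ) then D else emptyCell

open Classical in
/-- The matrix of the `t`-step restriction of the staircase: only the first `2t` cells. -/
noncomputable def StaircaseData.Mstep (S : StaircaseData) (C D : ∀ m, Set (Perm m)) (t : ℕ) :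
    ℕ → ℕ → ∀ m, Set (Perm m) :=
  fun k ℓ => if ∃ i < t, S.pos (2 * i) = (k, ℓ) then C
    else if ∃ i < t, S.pos (2 * i + 1) = (k, ℓ) then D else emptyCell

/-- The permutation `1` of length one. -/
def one1 : Perm 1 := 1

/-- The 0-1 matrix with support `A` contains the permutation matrix of `σ`. -/
def MatContains {k : ℕ} (σ : Perm k) (A : Finset (ℕ × ℕ)) : Prop :=
  ∃ f g : Fin k → ℕ, StrictMono f ∧ StrictMono g ∧ ∀ i, (f i, g (σ i)) ∈ A

/-- The index of the `s × s` block containing a given cell. -/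
def blockOf (s : ℕ) (x : ℕ × ℕ) : ℕ × ℕ := (x.1 / s, x.2 / s)

/-- The entries of `A` lying in the `s × s` block with index `b`. -/
def blockEntries (s : ℕ) (A : Finset (ℕ × ℕ)) (b : ℕ × ℕ) : Finset (ℕ × ℕ) :=
  A.filter fun x => blockOf s x = b

/-- The set of cells of an `n × n` matrix. -/
def cells (n : ℕ) : Finset (ℕ × ℕ) := Finset.range n ×ˢ Finset.range n

theorem mem_blockEntries {s : ℕ} {A : Finset (ℕ × ℕ)} {b x : ℕ × ℕ} :
    x ∈ blockEntries s A b ↔ x ∈ A ∧ x.1 / s = b.1 ∧ x.2 / s = b.2 := by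
  simp [blockEntries, blockOf, Prod.ext_iff]

theorem mem_cells {n : ℕ} {x : ℕ × ℕ} : x ∈ cells n ↔ x.1 < n ∧ x.2 < n := by
  simp [cells]

theorem MatContains.of_swap {k : ℕ} {σ : Perm k} {A : Finset (ℕ × ℕ)}
    (h : MatContains σ⁻¹ (A.image Prod.swap)) : MatContains σ A := by
  obtain ⟨f, g, hf, hg, h⟩ := h
  refine ⟨g, f, hg, hf, fun i => ?_⟩
  obtain ⟨⟨x, y⟩, hx, he⟩ := Finset.mem_image.1 (h (σ i))
  simp only [Prod.swap_prod_mk, Equiv.Perm.inv_def, Equiv.symm_apply_apply, Prod.mk.injEq] at he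
  rw [← he.1, ← he.2]
  exact hx

theorem MatContains.of_image_blockOf {k s : ℕ} {σ : Perm k} {A : Finset (ℕ × ℕ)}
    (h : MatContains σ (A.image (blockOf s))) : MatContains σ A := by
  obtain ⟨f, g, hf, hg, h⟩ := h
  choose x hxA hx using fun i => Finset.mem_image.1 (h i)
  simp only [blockOf, Prod.mk.injEq] at hx
  refine ⟨fun i => (x i).1, fun j => (x (σ⁻¹ j)).2, fun i j hij => ?_, fun i j hij => ?_,
    fun i => by simpa using hxA i⟩
  · refine Nat.lt_of_div_lt_div (c := s) ?_
    rw [(hx i).1, (hx j).1]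
    exact hf hij
  · refine Nat.lt_of_div_lt_div (c := s) ?_
    rw [(hx _).2, (hx _).2]
    simpa using hg hij

theorem image_blockOf_subset {s m : ℕ} {A : Finset (ℕ × ℕ)}
    (hA : A ⊆ cells (s * m)) : A.image (blockOf s) ⊆ cells m := by
  intro b hb
  obtain ⟨x, hx, rfl⟩ := Finset.mem_image.1 hb
  have := mem_cells.1 (hA hx)
  exact mem_cells.2 ⟨Nat.div_lt_of_lt_mul this.1, Nat.div_lt_of_lt_mul this.2⟩

/-- In a matrix avoiding a pattern of length `k`, the number of blocks with entries in at least
`k` columns is linear in the number of block columns. -/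
theorem card_wide_le {k s m : ℕ} (hs : 0 < s) {σ : Perm k} {A : Finset (ℕ × ℕ)}
    (hσ : ¬ MatContains σ A) (hA : A ⊆ cells (s * m)) :
    ((A.image (blockOf s)).filter
      fun b => k ≤ ((blockEntries s A b).image Prod.fst).card).card ≤ s.choose k * k * m := by
  have key := Finset.card_le_mul_card_image_of_maps_to (f := Prod.fst)
    (s := (A.image (blockOf s)).filter
      fun b => k ≤ ((blockEntries s A b).image Prod.fst).card) (t := Finset.range m) ?_
    (s.choose k * k) ?_
  · simpa using key
  · intro b hb
    exact Finset.mem_range.2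
      (mem_cells.1 (image_blockOf_subset hA (Finset.mem_filter.1 hb).1)).1
  intro j _
  by_contra! hcard
  have hex : ∀ b : ℕ × ℕ, ∃ S : Finset ℕ,
      k ≤ ((blockEntries s A b).image Prod.fst).card →
        S ⊆ (blockEntries s A b).image Prod.fst ∧ S.card = k := fun b => by
    by_cases h : k ≤ ((blockEntries s A b).image Prod.fst).card
    · obtain ⟨S, hS⟩ := Finset.exists_subset_card_eq h
      exact ⟨S, fun _ => hS⟩
    · exact ⟨∅, fun h' => absurd h' h⟩
  choose S hS using hex
  let W := ((A.image (blockOf s)).filter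
    fun b => k ≤ ((blockEntries s A b).image Prod.fst).card).filter fun b => b.1 = j
  obtain ⟨T, hT, hfib⟩ := Finset.exists_lt_card_fiber_of_mul_lt_card_of_maps_to (f := S)
    (s := W) (t := Finset.powersetCard k (Finset.Ico (j * s) (j * s + s))) (n := k)
    (by
      intro b hb
      obtain ⟨hb', rfl⟩ := Finset.mem_filter.1 hb
      obtain ⟨h1, h2⟩ := hS b (Finset.mem_filter.1 hb').2
      refine Finset.mem_powersetCard.2 ⟨fun c hc => ?_, h2⟩
      obtain ⟨x, hx, rfl⟩ := Finset.mem_image.1 (h1 hc)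
      have hx := (mem_blockEntries.1 hx).2.1
      have h3 := Nat.div_add_mod x.1 s
      have h4 := Nat.mod_lt x.1 hs
      rw [hx, mul_comm] at h3
      rw [Finset.mem_Ico]
      omega)
    (by simpa using hcard)
  let F := W.filter fun b => S b = T
  have hFmem : ∀ b ∈ F, b.1 = j ∧ T ⊆ (blockEntries s A b).image Prod.fst := by
    intro b hb
    obtain ⟨hb, hbT⟩ := Finset.mem_filter.1 hb
    obtain ⟨hb, hbj⟩ := Finset.mem_filter.1 hb
    exact ⟨hbj, hbT ▸ (hS b (Finset.mem_filter.1 hb).2).1⟩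
  have hrows : k ≤ (F.image Prod.snd).card := by
    rw [Finset.card_image_of_injOn]
    · exact hfib.le
    · intro b hb b' hb' h
      exact Prod.ext ((hFmem b hb).1.trans (hFmem b' hb').1.symm) h
  have hTk : T.card = k := (Finset.mem_powersetCard.1 hT).2
  let f := T.orderEmbOfFin hTk
  let g := (F.image Prod.snd).orderEmbOfCardLe hrows
  have hex : ∀ i, ∃ y, (f i, y) ∈ A ∧ y / s = g (σ i) := fun i => by
    obtain ⟨b, hb, hbg⟩ := Finset.mem_image.1 (Finset.orderEmbOfCardLe_mem _ hrows (σ i))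
    obtain ⟨⟨x, y⟩, hx, hxf⟩ :=
      Finset.mem_image.1 ((hFmem b hb).2 (Finset.orderEmbOfFin_mem T hTk i))
    obtain ⟨h1, h2, h3⟩ := mem_blockEntries.1 hx
    simp only at hxf h3
    exact ⟨y, hxf ▸ h1, h3.trans hbg⟩
  choose y hyA hy using hex
  refine hσ ⟨f, fun i => y (σ⁻¹ i), f.strictMono, fun i i' hii => ?_, fun i => by
    simpa using hyA i⟩
  refine Nat.lt_of_div_lt_div (c := s) ?_
  rw [hy, hy]
  simpa using hii

theorem blockEntries_swap (s : ℕ) (A : Finset (ℕ × ℕ)) (b : ℕ × ℕ) :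
    blockEntries s (A.image Prod.swap) b.swap = (blockEntries s A b).image Prod.swap := by
  ext ⟨x, y⟩
  simp [mem_blockEntries, and_comm]

/-- In a matrix avoiding a pattern of length `k`, the number of blocks with entries in at least
`k` rows is linear in the number of block rows. -/
theorem card_tall_le {k s m : ℕ} (hs : 0 < s) {σ : Perm k} {A : Finset (ℕ × ℕ)}
    (hσ : ¬ MatContains σ A) (hA : A ⊆ cells (s * m)) :
    ((A.image (blockOf s)).filter
      fun b => k ≤ ((blockEntries s A b).image Prod.snd).card).card ≤ s.choose k * k * m := by
  have key := card_wide_le (m := m) hs (σ := σ⁻¹) (A := A.image Prod.swap)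
    (fun h => hσ h.of_swap) (by
      intro x hx
      obtain ⟨y, hy, rfl⟩ := Finset.mem_image.1 hx
      exact mem_cells.2 (mem_cells.1 (hA hy)).symm)
  refine le_trans (Finset.card_le_card_of_injOn Prod.swap ?_
    Prod.swap_injective.injOn) key
  intro b hb
  obtain ⟨hb, hbk⟩ := Finset.mem_filter.1 hb
  obtain ⟨x, hx, rfl⟩ := Finset.mem_image.1 hb
  refine Finset.mem_filter.2 ⟨Finset.mem_image.2 ⟨x.swap, Finset.mem_image_of_mem _ hx, rfl⟩, ?_⟩
  rw [blockEntries_swap, Finset.image_image]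
  exact hbk

theorem card_blockEntries_le_sq {s : ℕ} (hs : 0 < s) (A : Finset (ℕ × ℕ)) (b : ℕ × ℕ) :
    (blockEntries s A b).card ≤ s ^ 2 := by
  have h : blockEntries s A b ⊆
      Finset.Ico (b.1 * s) (b.1 * s + s) ×ˢ Finset.Ico (b.2 * s) (b.2 * s + s) := by
    intro x hx
    obtain ⟨-, h1, h2⟩ := mem_blockEntries.1 hx
    have h3 := Nat.div_add_mod x.1 s
    have h4 := Nat.mod_lt x.1 hs
    have h5 := Nat.div_add_mod x.2 s
    have h6 := Nat.mod_lt x.2 hs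
    rw [h1, mul_comm] at h3
    rw [h2, mul_comm] at h5
    simp only [Finset.mem_product, Finset.mem_Ico]
    omega
  simpa [sq] using Finset.card_le_card h

/-- The Marcus–Tardos recursion. -/
theorem card_le_of_avoids_step {k s m : ℕ} (hs : 0 < s) {σ : Perm k} {A : Finset (ℕ × ℕ)}
    (hσ : ¬ MatContains σ A) (hA : A ⊆ cells (s * m)) :
    A.card ≤ k ^ 2 * (A.image (blockOf s)).card + 2 * s ^ 2 * (s.choose k * k) * m := by
  classical
  have hb : ∀ b, (blockEntries s A b).card ≤ k ^ 2
      + (if k ≤ ((blockEntries s A b).image Prod.fst).card then s ^ 2 else 0)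
      + (if k ≤ ((blockEntries s A b).image Prod.snd).card then s ^ 2 else 0) := by
    intro b
    have hsq := card_blockEntries_le_sq hs A b
    split_ifs with h1 h2 h2
    · omega
    · omega
    · omega
    · have h3 : blockEntries s A b ⊆
          (blockEntries s A b).image Prod.fst ×ˢ (blockEntries s A b).image Prod.snd :=
        fun x hx => Finset.mem_product.2
          ⟨Finset.mem_image_of_mem _ hx, Finset.mem_image_of_mem _ hx⟩
      have h4 := Finset.card_le_card h3
      rw [Finset.card_product] at h4
      have h5 := Nat.mul_le_mul (not_le.1 h1).le (not_le.1 h2).le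
      rw [sq]
      omega
  have hw := card_wide_le hs hσ hA
  have ht := card_tall_le hs hσ hA
  have hsum : A.card = ∑ b ∈ A.image (blockOf s), (blockEntries s A b).card :=
    Finset.card_eq_sum_card_fiberwise fun x hx => Finset.mem_image_of_mem _ hx
  have hle := Finset.sum_le_sum fun b (_ : b ∈ A.image (blockOf s)) => hb b
  rw [Finset.sum_add_distrib, Finset.sum_add_distrib, ← Finset.sum_filter, ← Finset.sum_filter,
    Finset.sum_const, Finset.sum_const, Finset.sum_const, smul_eq_mul, smul_eq_mul,
    smul_eq_mul] at hle
  have h1 := Nat.mul_le_mul_right (s ^ 2) hw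
  have h2 := Nat.mul_le_mul_right (s ^ 2) ht
  rw [hsum]
  nlinarith

/-- The Marcus–Tardos theorem for matrices whose size is a power of `(k + 1) ^ 2`. -/
theorem exists_card_le_of_avoids {k : ℕ} (σ : Perm k) :
    ∃ c : ℕ, ∀ r : ℕ, ∀ A : Finset (ℕ × ℕ), ¬ MatContains σ A →
      A ⊆ cells (((k + 1) ^ 2) ^ r) → A.card ≤ c * ((k + 1) ^ 2) ^ r := by
  set s := (k + 1) ^ 2 with hs
  have hs0 : 0 < s := by positivity
  refine ⟨2 * s ^ 2 * (s.choose k * k) + 1, fun r => ?_⟩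
  induction r with
  | zero =>
    intro A _ hA
    have := Finset.card_le_card hA
    simp [cells] at this ⊢
    omega
  | succ r ih =>
    intro A hσ hA
    rw [pow_succ'] at hA
    have h1 := card_le_of_avoids_step hs0 hσ hA
    have h2 := ih (A.image (blockOf s)) (fun h => hσ h.of_image_blockOf) (image_blockOf_subset hA)
    generalize 2 * s ^ 2 * (s.choose k * k) = M at *
    obtain ⟨N, hN⟩ : ∃ N, s ^ r = N := ⟨_, rfl⟩
    rw [hN] at h1 h2
    have h3 : s = k ^ 2 + 2 * k + 1 := by rw [hs]; ring
    have h4 := Nat.mul_le_mul_left (k ^ 2) h2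
    have h5 : (M + 1) * s ^ (r + 1) = (M + 1) * (k ^ 2 + 2 * k + 1) * s ^ r := by
      rw [pow_succ', ← h3, mul_assoc]
    rw [h5, hN]
    nlinarith [Nat.zero_le ((M + 1) * N * k)]

/-- Klazar's bound: the number of matrices avoiding a permutation matrix is at most
exponential in the side length. -/
theorem exists_card_avoiders_le {k : ℕ} (hk : 0 < k) (σ : Perm k) :
    ∃ K : ℕ, ∀ r : ℕ, ∀ 𝒯 : Finset (Finset (ℕ × ℕ)),
      (∀ A ∈ 𝒯, ¬ MatContains σ A ∧ A ⊆ cells (((k + 1) ^ 2) ^ r)) →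
        𝒯.card ≤ 2 ^ (K * ((k + 1) ^ 2) ^ r) := by
  obtain ⟨c, hc⟩ := exists_card_le_of_avoids σ
  set s := (k + 1) ^ 2 with hs
  have hs0 : 0 < s := by positivity
  have hs2 : 2 ≤ s := by rw [hs]; nlinarith
  refine ⟨s ^ 2 * c + 1, fun r => ?_⟩
  induction r with
  | zero =>
    intro 𝒯 h𝒯
    have h1 : 𝒯 ⊆ (cells 1).powerset := fun A hA =>
      Finset.mem_powerset.2 (by simpa using (h𝒯 A hA).2)
    have h2 := Finset.card_le_card h1
    simp only [cells, Finset.card_powerset, Finset.card_product, Finset.card_range] at h2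
    exact h2.trans (Nat.pow_le_pow_right two_pos (by simp))
  | succ r ih =>
    intro 𝒯 h𝒯
    have himg := ih (𝒯.image fun A => A.image (blockOf s)) (by
      intro B hB
      obtain ⟨A, hA, rfl⟩ := Finset.mem_image.1 hB
      refine ⟨fun h => (h𝒯 A hA).1 h.of_image_blockOf, image_blockOf_subset ?_⟩
      rw [← pow_succ']
      exact (h𝒯 A hA).2)
    have hfib : ∀ B ∈ 𝒯.image (fun A => A.image (blockOf s)),
        (𝒯.filter fun A => A.image (blockOf s) = B).card ≤ 2 ^ (s ^ 2 * c * s ^ r) := by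
      intro B hB
      have hBcard : B.card ≤ c * s ^ r := by
        obtain ⟨A, hA, rfl⟩ := Finset.mem_image.1 hB
        refine hc r _ (fun h => (h𝒯 A hA).1 h.of_image_blockOf) (image_blockOf_subset ?_)
        rw [← pow_succ']
        exact (h𝒯 A hA).2
      have hsub : (𝒯.filter fun A => A.image (blockOf s) = B) ⊆
          (B.biUnion (blockEntries s (cells (s ^ (r + 1))))).powerset := by
        intro A hA
        obtain ⟨hA, hAB⟩ := Finset.mem_filter.1 hA
        rw [← hAB]
        refine Finset.mem_powerset.2 fun x hx => Finset.mem_biUnion.2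
          ⟨blockOf s x, Finset.mem_image_of_mem _ hx, ?_⟩
        exact mem_blockEntries.2 ⟨(h𝒯 A hA).2 hx, rfl, rfl⟩
      refine (Finset.card_le_card hsub).trans ?_
      rw [Finset.card_powerset]
      refine Nat.pow_le_pow_right two_pos ?_
      refine (Finset.card_biUnion_le_card_mul _ _ (s ^ 2) fun b _ =>
        card_blockEntries_le_sq hs0 _ b).trans ?_
      nlinarith [Nat.mul_le_mul_right (s ^ 2) hBcard]
    have h3 := Finset.card_le_mul_card_image 𝒯 _ hfib
    refine h3.trans ((Nat.mul_le_mul_left _ himg).trans ?_)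
    rw [← pow_add]
    refine Nat.pow_le_pow_right two_pos ?_
    have h5 : 0 < s ^ r := by positivity
    rw [pow_succ s r]
    generalize s ^ r = N at *
    generalize s ^ 2 * c = M at *
    nlinarith [Nat.mul_le_mul_left ((M + 1) * N) hs2]

/-- The set of entries of the graph of a permutation. -/
def permMatrixSupport {n : ℕ} (π : Perm n) : Finset (ℕ × ℕ) :=
  Finset.univ.image fun i : Fin n => ((i : ℕ), (π i : ℕ))

theorem permMatrixSupport_injective {n : ℕ} :
    Function.Injective (permMatrixSupport : Perm n → Finset (ℕ × ℕ)) := by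
  intro π ρ h
  ext i
  have h1 : ((i : ℕ), (π i : ℕ)) ∈ permMatrixSupport ρ := by
    rw [← h]
    exact Finset.mem_image_of_mem _ (Finset.mem_univ i)
  obtain ⟨j, -, hj⟩ := Finset.mem_image.1 h1
  simp only [Prod.mk.injEq] at hj
  obtain ⟨h2, h3⟩ := hj
  rw [← h3, Fin.ext h2]

theorem Pattern.of_matContains {k n : ℕ} {σ : Perm k} {π : Perm n}
    (h : MatContains σ (permMatrixSupport π)) : Pattern σ π := by
  obtain ⟨f, g, hf, hg, h⟩ := h
  choose x _ hx using fun i => Finset.mem_image.1 (h i)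
  simp only [Prod.mk.injEq] at hx
  refine ⟨OrderEmbedding.ofStrictMono x fun i j hij => ?_, fun i j => ?_⟩
  · rw [Fin.lt_def, (hx i).1, (hx j).1]
    exact hf hij
  · change σ i < σ j ↔ (π (x i) : ℕ) < (π (x j) : ℕ)
    rw [(hx i).2, (hx j).2, hg.lt_iff_lt]

/-- The Stanley–Wilf conjecture (Marcus–Tardos theorem). -/
theorem exists_ncard_avSet_le {k : ℕ} (hk : 0 < k) (σ : Perm k) :
    ∃ K : ℕ, ∀ n : ℕ, 0 < n → (avSet σ n).ncard ≤ 2 ^ (K * n) := by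
  classical
  obtain ⟨K, hK⟩ := exists_card_avoiders_le hk σ
  set s := (k + 1) ^ 2 with hs
  have hs2 : 1 < s := by rw [hs]; nlinarith
  refine ⟨K * s, fun n hn => ?_⟩
  have h1 := hK (Nat.clog s n)
    ((Finset.univ.filter fun π : Perm n => π ∈ avSet σ n).image permMatrixSupport) (by
      intro A hA
      obtain ⟨π, hπ, rfl⟩ := Finset.mem_image.1 hA
      refine ⟨fun h => (Finset.mem_filter.1 hπ).2 (Pattern.of_matContains h), fun x hx => ?_⟩
      obtain ⟨i, -, rfl⟩ := Finset.mem_image.1 hx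
      have := Nat.le_pow_clog hs2 n
      exact mem_cells.2 ⟨i.2.trans_le this, (π i).2.trans_le this⟩)
  rw [Finset.card_image_of_injective _ permMatrixSupport_injective] at h1
  rw [Set.ncard_eq_toFinset_card', ← Set.filter_mem_univ_eq_toFinset]
  refine h1.trans (Nat.pow_le_pow_right two_pos ?_)
  rw [mul_assoc]
  refine Nat.mul_le_mul_left _ ?_
  rcases Nat.eq_zero_or_pos (Nat.clog s n) with h | h
  · rw [h, pow_zero]
    nlinarith
  · have h2 : s ^ (Nat.clog s n - 1) < n := by
      rw [← Nat.lt_clog_iff_pow_lt hs2]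
      omega
    calc s ^ Nat.clog s n = s * s ^ (Nat.clog s n - 1) := by
          rw [← pow_succ', Nat.sub_add_cancel h]
      _ ≤ s * n := Nat.mul_le_mul_left _ h2.le

/-- `f` lists the positions of an occurrence of `σ` in `π`. -/
structure Occ {k n : ℕ} (σ : Perm k) (π : Perm n) (f : Fin k → Fin n) : Prop where
  strictMono : StrictMono f
  lt_iff : ∀ i j, σ i < σ j ↔ π (f i) < π (f j)

theorem pattern_iff_exists_occ {k n : ℕ} {σ : Perm k} {π : Perm n} :
    Pattern σ π ↔ ∃ f, Occ σ π f :=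
  ⟨fun ⟨f, hf⟩ => ⟨f, f.strictMono, hf⟩,
    fun ⟨f, hf⟩ => ⟨OrderEmbedding.ofStrictMono f hf.strictMono, hf.lt_iff⟩⟩

theorem skewSum_castAdd {m n : ℕ} (π : Perm m) (σ : Perm n) (i : Fin m) :
    (skewSum π σ (Fin.castAdd n i) : ℕ) = n + π i := by
  simp [skewSum, add_comm]

theorem skewSum_natAdd {m n : ℕ} (π : Perm m) (σ : Perm n) (j : Fin n) :
    (skewSum π σ (Fin.natAdd m j) : ℕ) = σ j := by
  simp [skewSum]

theorem occ_skewSum_iff {a b n : ℕ} {α : Perm a} {β : Perm b} {π : Perm n}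
    {h : Fin (a + b) → Fin n} :
    Occ (skewSum α β) π h ↔ Occ α π (fun i => h (Fin.castAdd b i)) ∧
      Occ β π (fun j => h (Fin.natAdd a j)) ∧
      ∀ i j, h (Fin.castAdd b i) < h (Fin.natAdd a j) ∧
        π (h (Fin.natAdd a j)) < π (h (Fin.castAdd b i)) := by
  constructor
  · rintro ⟨hm, hlt⟩
    refine ⟨⟨fun i j hij => hm (Fin.lt_def.2 (by simpa using hij)), fun i j => ?_⟩,
      ⟨fun i j hij => hm (Fin.lt_def.2 (by simpa using hij)), fun i j => ?_⟩,
      fun i j => ⟨hm ?_, ?_⟩⟩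
    · rw [← hlt, Fin.lt_def, Fin.lt_def, skewSum_castAdd, skewSum_castAdd]
      omega
    · rw [← hlt, Fin.lt_def, Fin.lt_def, skewSum_natAdd, skewSum_natAdd]
    · rw [Fin.lt_def, Fin.val_natAdd, Fin.val_castAdd]
      omega
    · rw [← hlt, Fin.lt_def, skewSum_castAdd, skewSum_natAdd]
      omega
  · rintro ⟨hf, hg, hfg⟩
    refine ⟨?_, ?_⟩
    · intro x y
      refine Fin.addCases (fun i => ?_) (fun i => ?_) x <;>
        refine Fin.addCases (fun j => ?_) (fun j => ?_) y <;> intro h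
      · exact hf.strictMono (Fin.lt_def.2 (by simpa using Fin.lt_def.1 h))
      · exact (hfg i j).1
      · rw [Fin.lt_def, Fin.val_natAdd, Fin.val_castAdd] at h
        omega
      · exact hg.strictMono (Fin.lt_def.2 (by simpa using Fin.lt_def.1 h))
    · intro x y
      refine Fin.addCases (fun i => ?_) (fun i => ?_) x <;>
        refine Fin.addCases (fun j => ?_) (fun j => ?_) y
      · rw [← hf.lt_iff, Fin.lt_def, Fin.lt_def, skewSum_castAdd, skewSum_castAdd]
        omega
      · rw [Fin.lt_def, skewSum_castAdd, skewSum_natAdd]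
        have := (hfg i j).2
        constructor
        · omega
        · exact fun h => absurd h this.not_gt
      · rw [Fin.lt_def, skewSum_castAdd, skewSum_natAdd]
        have := (hfg j i).2
        simp only [this, iff_true]
        omega
      · rw [← hg.lt_iff, Fin.lt_def, Fin.lt_def, skewSum_natAdd, skewSum_natAdd]

theorem pattern_skewSum_iff {a b n : ℕ} {α : Perm a} {β : Perm b} {π : Perm n} :
    Pattern (skewSum α β) π ↔ ∃ f g, Occ α π f ∧ Occ β π g ∧
      ∀ i j, f i < g j ∧ π (g j) < π (f i) := by
  rw [pattern_iff_exists_occ]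
  constructor
  · rintro ⟨h, hh⟩
    exact ⟨_, _, occ_skewSum_iff.1 hh⟩
  · rintro ⟨f, g, h⟩
    exact ⟨Fin.addCases f g, occ_skewSum_iff.2 (by simpa using h)⟩

theorem occ_one1 {n : ℕ} (π : Perm n) (f : Fin 1 → Fin n) : Occ one1 π f :=
  ⟨Subsingleton.strictMono f, fun i j => by simp [Subsingleton.elim i j]⟩

theorem pattern_skewSum_one1_iff {a n : ℕ} {α : Perm a} {π : Perm n} :
    Pattern (skewSum α one1) π ↔ ∃ f x, Occ α π f ∧ ∀ i, f i < x ∧ π x < π (f i) := by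
  rw [pattern_skewSum_iff]
  constructor
  · rintro ⟨f, g, hf, -, h⟩
    exact ⟨f, g 0, hf, fun i => h i 0⟩
  · rintro ⟨f, x, hf, h⟩
    exact ⟨f, fun _ => x, hf, occ_one1 _ _, fun i _ => h i⟩

theorem pattern_one1_skewSum_iff {c n : ℕ} {γ : Perm c} {π : Perm n} :
    Pattern (skewSum one1 γ) π ↔ ∃ x g, Occ γ π g ∧ ∀ j, x < g j ∧ π (g j) < π x := by
  rw [pattern_skewSum_iff]
  constructor
  · rintro ⟨f, g, -, hg, h⟩
    exact ⟨f 0, g, hg, fun j => h 0 j⟩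
  · rintro ⟨x, g, hg, h⟩
    exact ⟨fun _ => x, g, occ_one1 _ _, hg, fun _ j => h j⟩

theorem pattern_triple_iff {a c n : ℕ} {α : Perm a} {γ : Perm c} {π : Perm n} :
    Pattern (skewSum α (skewSum one1 γ)) π ↔ ∃ f x g, Occ α π f ∧ Occ γ π g ∧
      (∀ i, f i < x ∧ π x < π (f i)) ∧ ∀ j, x < g j ∧ π (g j) < π x := by
  rw [pattern_skewSum_iff]
  constructor
  · rintro ⟨f, h, hf, hh, hfh⟩
    obtain ⟨-, hg, hxg⟩ := occ_skewSum_iff.1 hh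
    exact ⟨f, _, _, hf, hg, fun i => hfh i _, fun j => hxg 0 j⟩
  · rintro ⟨f, x, g, hf, hg, hfx, hxg⟩
    refine ⟨f, Fin.addCases (fun _ => x) g, hf, occ_skewSum_iff.2 ⟨occ_one1 _ _, ?_, ?_⟩, ?_⟩
    · simpa using hg
    · simpa using hxg
    · intro i j
      refine Fin.addCases (fun _ => ?_) (fun j => ?_) j
      · simpa using hfx i
      · simpa using ⟨(hfx i).1.trans (hxg j).1, (hxg j).2.trans (hfx i).2⟩

/-- `e` interleaves a sequence of length `k` with one of length `l`. -/
structure IsShuffle {k l n : ℕ} (e : Fin k ⊕ Fin l ≃ Fin n) : Prop where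
  inl : StrictMono fun i => e (Sum.inl i)
  inr : StrictMono fun j => e (Sum.inr j)

theorem IsShuffle.eq_of_range_eq {k l n : ℕ} {e e' : Fin k ⊕ Fin l ≃ Fin n} (he : IsShuffle e)
    (he' : IsShuffle e')
    (h : Set.range (fun i => e (Sum.inl i)) = Set.range fun i => e' (Sum.inl i)) : e = e' := by
  have hc : ∀ e : Fin k ⊕ Fin l ≃ Fin n,
      Set.range (fun j => e (Sum.inr j)) = (Set.range fun i => e (Sum.inl i))ᶜ := by
    intro e
    ext x
    obtain ⟨y, rfl⟩ := e.surjective x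
    rcases y with i | j <;> simp
  have hl := (he.inl.range_inj he'.inl).1 h
  have hr := (he.inr.range_inj he'.inr).1 (by rw [hc, hc, h])
  ext x
  rcases x with i | j
  · exact congrArg Fin.val (congrFun hl i)
  · exact congrArg Fin.val (congrFun hr j)

theorem isShuffle_finSumFinEquiv (m n : ℕ) :
    IsShuffle (finSumFinEquiv : Fin m ⊕ Fin n ≃ Fin (m + n)) :=
  ⟨fun i j h => Fin.lt_def.2 (by simpa using h), fun i j h => Fin.lt_def.2 (by simpa using h)⟩

theorem finSumFinEquiv_inl_lt_inr {m n : ℕ} (i : Fin m) (j : Fin n) :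
    finSumFinEquiv (Sum.inl i : Fin m ⊕ Fin n) < finSumFinEquiv (Sum.inr j) := by
  rw [finSumFinEquiv_apply_left, finSumFinEquiv_apply_right, Fin.lt_def, Fin.val_natAdd,
    Fin.val_castAdd]
  omega

/-- The permutation obtained by interleaving `π` and `σ` by position according to `e` and by value
according to `f`. -/
def shuffleMerge {k l n : ℕ} (π : Perm k) (σ : Perm l) (e f : Fin k ⊕ Fin l ≃ Fin n) : Perm n :=
  e.symm.trans ((Equiv.sumCongr π σ).trans f)

section shuffleMerge

variable {k l n : ℕ} {π π' : Perm k} {σ σ' : Perm l} {e e' f f' : Fin k ⊕ Fin l ≃ Fin n}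

theorem shuffleMerge_inl (i : Fin k) :
    shuffleMerge π σ e f (e (Sum.inl i)) = f (Sum.inl (π i)) := by
  simp [shuffleMerge]

theorem shuffleMerge_inr (j : Fin l) :
    shuffleMerge π σ e f (e (Sum.inr j)) = f (Sum.inr (σ j)) := by
  simp [shuffleMerge]

theorem shuffleMerge_inv : (shuffleMerge π σ e f)⁻¹ = shuffleMerge π⁻¹ σ⁻¹ f e := rfl

theorem range_inl_subset_of_shuffleMerge_eq (h : shuffleMerge π σ e f = shuffleMerge π' σ' e' f) :
    Set.range (fun i => e (Sum.inl i)) ⊆ Set.range fun i => e' (Sum.inl i) := by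
  rintro _ ⟨i, rfl⟩
  obtain ⟨y, hy⟩ := e'.surjective (e (Sum.inl i))
  rcases y with i' | j'
  · exact ⟨i', hy⟩
  · have h1 := Equiv.congr_fun h (e (Sum.inl i))
    rw [shuffleMerge_inl, ← hy, shuffleMerge_inr] at h1
    simp at h1

theorem shuffleMerge_inj_left (he : IsShuffle e) (he' : IsShuffle e')
    (h : shuffleMerge π σ e f = shuffleMerge π' σ' e' f) : π = π' ∧ σ = σ' ∧ e = e' := by
  obtain rfl := he.eq_of_range_eq he' ((range_inl_subset_of_shuffleMerge_eq h).antisymm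
    (range_inl_subset_of_shuffleMerge_eq h.symm))
  refine ⟨Equiv.ext fun i => ?_, Equiv.ext fun j => ?_, rfl⟩
  · have h1 := Equiv.congr_fun h (e (Sum.inl i))
    rw [shuffleMerge_inl, shuffleMerge_inl] at h1
    simpa using h1
  · have h1 := Equiv.congr_fun h (e (Sum.inr j))
    rw [shuffleMerge_inr, shuffleMerge_inr] at h1
    simpa using h1

theorem shuffleMerge_inj_right (hf : IsShuffle f) (hf' : IsShuffle f')
    (h : shuffleMerge π σ e f = shuffleMerge π' σ' e f') : π = π' ∧ σ = σ' ∧ f = f' := by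
  have h1 := congrArg (·⁻¹) h
  simp only [shuffleMerge_inv] at h1
  obtain ⟨h2, h3, h4⟩ := shuffleMerge_inj_left hf hf' h1
  exact ⟨inv_injective h2, inv_injective h3, h4⟩

theorem shuffleMerge_inl_lt_inl (hf : IsShuffle f) {x y : Fin k} :
    shuffleMerge π σ e f (e (Sum.inl x)) < shuffleMerge π σ e f (e (Sum.inl y)) ↔ π x < π y := by
  rw [shuffleMerge_inl, shuffleMerge_inl]
  exact hf.inl.lt_iff_lt

theorem shuffleMerge_inr_lt_inr (hf : IsShuffle f) {x y : Fin l} :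
    shuffleMerge π σ e f (e (Sum.inr x)) < shuffleMerge π σ e f (e (Sum.inr y)) ↔ σ x < σ y := by
  rw [shuffleMerge_inr, shuffleMerge_inr]
  exact hf.inr.lt_iff_lt

theorem occ_shuffleMerge_inl (he : IsShuffle e) (hf : IsShuffle f) {m : ℕ} {τ : Perm m}
    {g : Fin m → Fin k} :
    Occ τ (shuffleMerge π σ e f) (fun i => e (Sum.inl (g i))) ↔ Occ τ π g := by
  constructor
  · rintro ⟨h1, h2⟩
    refine ⟨fun i j hij => he.inl.lt_iff_lt.1 (h1 hij), fun i j => ?_⟩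
    rw [h2, shuffleMerge_inl_lt_inl hf]
  · rintro ⟨h1, h2⟩
    refine ⟨fun i j hij => he.inl (h1 hij), fun i j => ?_⟩
    rw [h2, shuffleMerge_inl_lt_inl hf]

theorem occ_shuffleMerge_inr (he : IsShuffle e) (hf : IsShuffle f) {m : ℕ} {τ : Perm m}
    {g : Fin m → Fin l} :
    Occ τ (shuffleMerge π σ e f) (fun i => e (Sum.inr (g i))) ↔ Occ τ σ g := by
  constructor
  · rintro ⟨h1, h2⟩
    refine ⟨fun i j hij => he.inr.lt_iff_lt.1 (h1 hij), fun i j => ?_⟩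
    rw [h2, shuffleMerge_inr_lt_inr hf]
  · rintro ⟨h1, h2⟩
    refine ⟨fun i j hij => he.inr (h1 hij), fun i j => ?_⟩
    rw [h2, shuffleMerge_inr_lt_inr hf]

end shuffleMerge

theorem le_of_forall_pow_le {x G C : ℝ} (hG : 0 < G)
    (h : ∀ t : ℕ, x ^ t ≤ C * (t + 1) * G ^ t) : x ≤ G := by
  by_contra! hx
  have hr : 1 < x / G := (one_lt_div hG).2 hx
  have h0 := tendsto_pow_const_div_const_pow_of_one_lt 0 hr
  have h1 := tendsto_pow_const_div_const_pow_of_one_lt 1 hr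
  have h2 := (h1.add h0).const_mul C
  rw [add_zero, mul_zero] at h2
  obtain ⟨t, ht⟩ := (h2.eventually (gt_mem_nhds one_pos)).exists
  rw [pow_one, pow_zero, ← add_div, mul_div_assoc', div_lt_one (by positivity), div_pow,
    lt_div_iff₀ (by positivity)] at ht
  exact (h t).not_gt ht

/-- A supermultiplicative, at most exponentially growing sequence has a growth rate. -/
theorem exists_growth_of_supermultiplicative {u : ℕ → ℕ} {K : ℕ} (hpos : ∀ n, 0 < u n)
    (hmul : ∀ m n, u m * u n ≤ u (m + n)) (hK : ∀ n, 0 < n → u n ≤ 2 ^ (K * n)) :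
    ∃ g : ℝ, 1 ≤ g ∧ Tendsto (fun n : ℕ => (u n : ℝ) ^ ((n : ℝ)⁻¹)) atTop (𝓝 g) ∧
      ∀ n, (u n : ℝ) ≤ g ^ n := by
  have hpos' : ∀ n, (0 : ℝ) < u n := fun n => by exact_mod_cast hpos n
  have hsub : Subadditive fun n => -Real.log (u n) := fun m n => by
    have h1 : (u m : ℝ) * u n ≤ u (m + n) := by exact_mod_cast hmul m n
    have h2 := Real.log_le_log (mul_pos (hpos' m) (hpos' n)) h1
    rw [Real.log_mul (hpos' m).ne' (hpos' n).ne'] at h2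
    linarith
  have hbdd : BddBelow (Set.range fun n : ℕ => -Real.log (u n) / n) := by
    refine ⟨-(K * Real.log 2), ?_⟩
    rintro _ ⟨n, rfl⟩
    rcases Nat.eq_zero_or_pos n with rfl | hn
    · have : 0 ≤ Real.log 2 := Real.log_nonneg one_le_two
      change -(K * Real.log 2) ≤ -Real.log (u 0) / ((0 : ℕ) : ℝ)
      rw [Nat.cast_zero, _root_.div_zero, neg_nonpos]
      positivity
    · have hn' : (0 : ℝ) < n := by exact_mod_cast hn
      have h1 : (u n : ℝ) ≤ 2 ^ (K * n) := by exact_mod_cast hK n hn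
      have h2 := Real.log_le_log (hpos' n) h1
      rw [Real.log_pow] at h2
      push_cast at h2
      rw [le_div_iff₀ hn']
      linarith
  have hlim := (Real.continuous_exp.tendsto _).comp (hsub.tendsto_lim hbdd).neg
  have hle : ∀ n, 0 < n → Real.log (u n) ≤ n * -hsub.lim := fun n hn => by
    have h1 := hsub.lim_le_div hbdd hn.ne'
    rw [le_div_iff₀ (by exact_mod_cast hn)] at h1
    linarith
  refine ⟨Real.exp (-hsub.lim), ?_, ?_, fun n => ?_⟩
  · have h1 := hle 1 one_pos
    have h2 : 0 ≤ Real.log (u 1) := Real.log_nonneg (by exact_mod_cast hpos 1)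
    rw [Nat.cast_one, one_mul] at h1
    exact Real.one_le_exp (h2.trans h1)
  · refine hlim.congr fun n => ?_
    simp only [Function.comp_apply]
    rw [Real.rpow_def_of_pos (hpos' n)]
    congr 1
    ring
  · rw [← Real.exp_nat_mul, ← Real.log_le_iff_le_exp (hpos' n)]
    rcases Nat.eq_zero_or_pos n with rfl | hn
    · have h1 : u 0 ≤ 1 := Nat.le_of_mul_le_mul_left
        (by simpa using hmul 0 0) (hpos 0)
      have h2 : u 0 = 1 := le_antisymm h1 (hpos 0)
      simp [h2]
    · exact hle n hn

theorem exists_mul_pow_le_of_tendsto {u : ℕ → ℕ} {g h : ℝ} (hpos : ∀ n, 0 < u n)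
    (hu : Tendsto (fun n : ℕ => (u n : ℝ) ^ ((n : ℝ)⁻¹)) atTop (𝓝 g)) (h0 : 0 ≤ h) (hg : h < g) :
    ∃ C : ℝ, 0 < C ∧ ∀ n, C * h ^ n ≤ u n := by
  obtain ⟨N, hN⟩ := eventually_atTop.1 (hu.eventually (lt_mem_nhds hg))
  have h1 : 1 ≤ 1 + h := by linarith
  refine ⟨((1 + h) ^ (N + 1))⁻¹, by positivity, fun n => ?_⟩
  rw [inv_mul_le_iff₀ (by positivity)]
  rcases lt_or_ge n (N + 1) with hn | hn
  · have h2 : (1 : ℝ) ≤ u n := by exact_mod_cast hpos n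
    calc h ^ n ≤ (1 + h) ^ n := pow_le_pow_left₀ h0 (by linarith) n
      _ ≤ (1 + h) ^ (N + 1) := pow_le_pow_right₀ h1 hn.le
      _ ≤ (1 + h) ^ (N + 1) * u n := le_mul_of_one_le_right (by positivity) h2
  · have h2 := hN n (by omega)
    have h3 := pow_le_pow_left₀ h0 h2.le n
    rw [Real.rpow_inv_natCast_pow (Nat.cast_nonneg _) (by omega)] at h3
    exact h3.trans (le_mul_of_one_le_left (Nat.cast_nonneg _) (one_le_pow₀ h1))

/-- The growth rate of a sequence squeezed between the counts of a staircase and of a merge. -/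
theorem growth_eq_sq_sqrt_add_sqrt {u v w : ℕ → ℕ} {g₁ g₂ g₃ : ℝ}
    (hu0 : ∀ n, 0 < u n) (hv0 : ∀ n, 0 < v n)
    (hg₁ : 1 ≤ g₁) (hg₂ : 1 ≤ g₂) (hg₃ : 1 ≤ g₃)
    (hu : Tendsto (fun n : ℕ => (u n : ℝ) ^ ((n : ℝ)⁻¹)) atTop (𝓝 g₁))
    (hv : Tendsto (fun n : ℕ => (v n : ℝ) ^ ((n : ℝ)⁻¹)) atTop (𝓝 g₂))
    (hw : Tendsto (fun n : ℕ => (w n : ℝ) ^ ((n : ℝ)⁻¹)) atTop (𝓝 g₃))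
    (hu' : ∀ n, (u n : ℝ) ≤ g₁ ^ n) (hv' : ∀ n, (v n : ℝ) ≤ g₂ ^ n)
    (hw' : ∀ n, (w n : ℝ) ≤ g₃ ^ n)
    (hupper : ∀ n, w n ≤ ∑ k ∈ Finset.range (n + 1), n.choose k ^ 2 * (u k * v (n - k)))
    (hlower : ∀ p q t, (u p * v q * (p + q).choose p ^ 2) ^ t ≤ w (q + t * (p + q))) :
    g₃ = (Real.sqrt g₁ + Real.sqrt g₂) ^ 2 := by
  have hs₁ : Real.sqrt g₁ ^ 2 = g₁ := Real.sq_sqrt (by linarith)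
  have hs₂ : Real.sqrt g₂ ^ 2 = g₂ := Real.sq_sqrt (by linarith)
  have hs₃ : Real.sqrt g₃ ^ 2 = g₃ := Real.sq_sqrt (by linarith)
  have hp₁ : 0 < Real.sqrt g₁ := Real.sqrt_pos.2 (by linarith)
  have hp₂ : 0 < Real.sqrt g₂ := Real.sqrt_pos.2 (by linarith)
  have hp₃ : 0 < Real.sqrt g₃ := Real.sqrt_pos.2 (by linarith)
  set a := Real.sqrt g₁
  set b := Real.sqrt g₂
  set c := Real.sqrt g₃
  have hle : g₃ ≤ (a + b) ^ 2 := by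
    refine le_of_tendsto hw ?_
    filter_upwards [eventually_gt_atTop 0] with n hn
    have h1 : (w n : ℝ) ≤ ((a + b) ^ n) ^ 2 := by
      calc (w n : ℝ) ≤ ∑ k ∈ Finset.range (n + 1), (n.choose k : ℝ) ^ 2 * (u k * v (n - k)) := by
            exact_mod_cast hupper n
        _ ≤ ∑ k ∈ Finset.range (n + 1), (a ^ k * b ^ (n - k) * n.choose k) ^ 2 := by
            refine Finset.sum_le_sum fun k _ => ?_
            have h2 := mul_le_mul (hu' k) (hv' (n - k)) (Nat.cast_nonneg _) (by positivity)
            have h3 : (a ^ k * b ^ (n - k) * (n.choose k : ℝ)) ^ 2 =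
                (n.choose k : ℝ) ^ 2 * (g₁ ^ k * g₂ ^ (n - k)) := by
              rw [← hs₁, ← hs₂]
              ring
            rw [h3]
            gcongr
        _ ≤ (∑ k ∈ Finset.range (n + 1), a ^ k * b ^ (n - k) * n.choose k) ^ 2 :=
            Finset.sum_sq_le_sq_sum_of_nonneg fun k _ => by positivity
        _ = _ := by rw [← add_pow]
    calc (w n : ℝ) ^ ((n : ℝ)⁻¹) ≤ (((a + b) ^ n) ^ 2) ^ ((n : ℝ)⁻¹) := by
          gcongr
      _ = (a + b) ^ 2 := by
          rw [← pow_mul, mul_comm, pow_mul, Real.pow_rpow_inv_natCast (by positivity) hn.ne']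
  have hpq : ∀ p q, (u p : ℝ) * v q * ((p + q).choose p : ℝ) ^ 2 ≤ g₃ ^ (p + q) := by
    intro p q
    refine le_of_forall_pow_le (C := g₃ ^ q) (by positivity) fun t => ?_
    calc ((u p : ℝ) * v q * ((p + q).choose p : ℝ) ^ 2) ^ t ≤ w (q + t * (p + q)) := by
          exact_mod_cast hlower p q t
      _ ≤ g₃ ^ (q + t * (p + q)) := hw' _
      _ = g₃ ^ q * 1 * (g₃ ^ (p + q)) ^ t := by rw [pow_add, mul_comm t, pow_mul, mul_one]
      _ ≤ g₃ ^ q * (t + 1) * (g₃ ^ (p + q)) ^ t := by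
          gcongr
          linarith [(Nat.cast_nonneg t : (0 : ℝ) ≤ t)]
  have hθ : ∀ θ : ℝ, 0 < θ → θ < 1 → θ * (a + b) ≤ c := by
    intro θ hθ0 hθ1
    have hθ2 : θ ^ 2 < 1 := by nlinarith
    obtain ⟨C₁, hC₁, h₁⟩ := exists_mul_pow_le_of_tendsto (h := θ ^ 2 * g₁) hu0 hu
      (by positivity) (by nlinarith)
    obtain ⟨C₂, hC₂, h₂⟩ := exists_mul_pow_le_of_tendsto (h := θ ^ 2 * g₂) hv0 hv
      (by positivity) (by nlinarith)
    set D := Real.sqrt (C₁ * C₂) with hD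
    have hD0 : 0 < D := Real.sqrt_pos.2 (by positivity)
    have hD2 : D ^ 2 = C₁ * C₂ := Real.sq_sqrt (by positivity)
    refine le_of_forall_pow_le (C := D⁻¹) hp₃ fun n => ?_
    have hterm : ∀ k ∈ Finset.range (n + 1),
        D * ((θ * a) ^ k * (θ * b) ^ (n - k) * n.choose k) ≤ c ^ n := by
      intro k hk
      have hkn : k + (n - k) = n := by
        have := Finset.mem_range.1 hk
        omega
      refine le_of_sq_le_sq ?_ (by positivity)
      have h3 := hpq k (n - k)
      rw [hkn] at h3
      calc (D * ((θ * a) ^ k * (θ * b) ^ (n - k) * n.choose k)) ^ 2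
          = (C₁ * (θ ^ 2 * g₁) ^ k) * (C₂ * (θ ^ 2 * g₂) ^ (n - k)) * (n.choose k : ℝ) ^ 2 := by
            rw [← hs₁, ← hs₂, mul_pow D, hD2]
            ring
        _ ≤ u k * v (n - k) * (n.choose k : ℝ) ^ 2 := by
            gcongr
            · exact h₁ k
            · exact h₂ (n - k)
        _ ≤ g₃ ^ n := h3
        _ = (c ^ n) ^ 2 := by
            rw [← hs₃]
            ring
    have hsum := Finset.sum_le_sum hterm
    rw [← Finset.mul_sum, ← add_pow, Finset.sum_const, Finset.card_range, nsmul_eq_mul] at hsum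
    push_cast at hsum
    rw [← mul_add] at hsum
    rw [mul_assoc, inv_mul_eq_div, le_div_iff₀ hD0]
    linarith
  have hge : a + b ≤ c := by
    by_contra! hlt
    obtain ⟨θ, h1, h2⟩ := exists_between ((div_lt_one (by positivity)).2 hlt)
    refine (hθ θ (lt_trans (by positivity) h1) h2).not_gt ?_
    rwa [div_lt_iff₀ (by positivity)] at h1
  refine le_antisymm hle ?_
  rw [← hs₃]
  gcongr

theorem one_mem_avSet_skewSum {a b : ℕ} (ha : 0 < a) (hb : 0 < b) (α : Perm a) (β : Perm b)
    (n : ℕ) : (1 : Perm n) ∈ avSet (skewSum α β) n := by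
  intro h
  obtain ⟨f, g, -, -, hfg⟩ := pattern_skewSum_iff.1 h
  exact lt_asymm (hfg ⟨0, ha⟩ ⟨0, hb⟩).1 (hfg ⟨0, ha⟩ ⟨0, hb⟩).2

/-- Every member of a family of positions not met by the second part comes from the first. -/
theorem exists_eq_inl_of_forall_ne {k l n m : ℕ} (e : Fin k ⊕ Fin l ≃ Fin n) {h : Fin m → Fin n}
    (hne : ∀ i j, h i ≠ e (Sum.inr j)) : ∃ h' : Fin m → Fin k, h = fun i => e (Sum.inl (h' i)) := by
  have hex : ∀ i, ∃ x, h i = e (Sum.inl x) := fun i => by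
    obtain ⟨y | y, hy⟩ := e.surjective (h i)
    · exact ⟨y, hy.symm⟩
    · exact absurd hy.symm (hne i y)
  choose h' hh' using hex
  exact ⟨h', funext hh'⟩

theorem exists_eq_inr_of_forall_ne {k l n m : ℕ} (e : Fin k ⊕ Fin l ≃ Fin n) {h : Fin m → Fin n}
    (hne : ∀ i j, h i ≠ e (Sum.inl j)) : ∃ h' : Fin m → Fin l, h = fun i => e (Sum.inr (h' i)) := by
  have hex : ∀ i, ∃ x, h i = e (Sum.inr x) := fun i => by
    obtain ⟨y | y, hy⟩ := e.surjective (h i)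
    · exact absurd hy.symm (hne i y)
    · exact ⟨y, hy.symm⟩
  choose h' hh' using hex
  exact ⟨h', funext hh'⟩

section

variable {k l n : ℕ} {π : Perm k} {σ : Perm l} {e f : Fin k ⊕ Fin l ≃ Fin n}

/-- If all of `f`'s second-part values exceed all first-part values, entries below a first-part
entry are first-part entries. -/
theorem ne_inr_of_shuffleMerge_lt {i : Fin k} {y : Fin n}
    (hf : ∀ j, f (Sum.inl (π i)) < f (Sum.inr j))
    (h : shuffleMerge π σ e f y < shuffleMerge π σ e f (e (Sum.inl i))) (j : Fin l) :
    y ≠ e (Sum.inr j) := by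
  rintro rfl
  rw [shuffleMerge_inl, shuffleMerge_inr] at h
  exact (hf _).not_gt h

theorem ne_inl_of_lt_shuffleMerge {j : Fin l} {y : Fin n}
    (hf : ∀ i, f (Sum.inl i) < f (Sum.inr (σ j)))
    (h : shuffleMerge π σ e f (e (Sum.inr j)) < shuffleMerge π σ e f y) (i : Fin k) :
    y ≠ e (Sum.inl i) := by
  rintro rfl
  rw [shuffleMerge_inl, shuffleMerge_inr] at h
  exact (hf _).not_gt h

theorem ne_inr_of_lt_inl {i : Fin k} {y : Fin n} (he : ∀ j, e (Sum.inl i) < e (Sum.inr j))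
    (h : y < e (Sum.inl i)) (j : Fin l) : y ≠ e (Sum.inr j) := by
  rintro rfl
  exact (he j).not_gt h

theorem ne_inl_of_inr_lt {j : Fin l} {y : Fin n} (he : ∀ i, e (Sum.inl i) < e (Sum.inr j))
    (h : e (Sum.inr j) < y) (i : Fin k) : y ≠ e (Sum.inl i) := by
  rintro rfl
  exact (he i).not_gt h

end

theorem shuffleMerge_mem_avSet {a b m n : ℕ} (ha : 0 < a) (hb : 0 < b) {α : Perm a} {β : Perm b}
    {π : Perm m} {σ : Perm n} (hπ : π ∈ avSet (skewSum α β) m) (hσ : σ ∈ avSet (skewSum α β) n) :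
    shuffleMerge π σ finSumFinEquiv finSumFinEquiv ∈ avSet (skewSum α β) (m + n) := by
  intro h
  obtain ⟨f, g, hf, hg, hfg⟩ := pattern_skewSum_iff.1 h
  have hs := isShuffle_finSumFinEquiv m n
  obtain ⟨y | y, hy⟩ := (finSumFinEquiv : Fin m ⊕ Fin n ≃ _).surjective (g ⟨0, hb⟩)
  · obtain ⟨f, rfl⟩ := exists_eq_inl_of_forall_ne finSumFinEquiv (h := f) fun i =>
      ne_inr_of_lt_inl (i := y) (finSumFinEquiv_inl_lt_inr _) (hy ▸ (hfg i ⟨0, hb⟩).1)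
    obtain ⟨g, rfl⟩ := exists_eq_inl_of_forall_ne finSumFinEquiv (h := g) fun j =>
      ne_inr_of_shuffleMerge_lt (finSumFinEquiv_inl_lt_inr _) (hfg ⟨0, ha⟩ j).2
    refine hπ (pattern_skewSum_iff.2 ⟨f, g, (occ_shuffleMerge_inl hs hs).1 hf,
      (occ_shuffleMerge_inl hs hs).1 hg, fun i j => ⟨hs.inl.lt_iff_lt.1 (hfg i j).1,
        (shuffleMerge_inl_lt_inl hs).1 (hfg i j).2⟩⟩)
  · obtain ⟨f, rfl⟩ := exists_eq_inr_of_forall_ne finSumFinEquiv (h := f) fun i =>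
      ne_inl_of_lt_shuffleMerge (j := y) (fun i => finSumFinEquiv_inl_lt_inr i _)
        (hy ▸ (hfg i ⟨0, hb⟩).2)
    obtain ⟨g, rfl⟩ := exists_eq_inr_of_forall_ne finSumFinEquiv (h := g) fun j =>
      ne_inl_of_inr_lt (fun i => finSumFinEquiv_inl_lt_inr i _) (hfg ⟨0, ha⟩ j).1
    refine hσ (pattern_skewSum_iff.2 ⟨f, g, (occ_shuffleMerge_inr hs hs).1 hf,
      (occ_shuffleMerge_inr hs hs).1 hg, fun i j => ⟨hs.inr.lt_iff_lt.1 (hfg i j).1,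
        (shuffleMerge_inr_lt_inr hs).1 (hfg i j).2⟩⟩)

theorem ncard_avSet_skewSum_mul_le {a b : ℕ} (ha : 0 < a) (hb : 0 < b) (α : Perm a) (β : Perm b)
    (m n : ℕ) : (avSet (skewSum α β) m).ncard * (avSet (skewSum α β) n).ncard ≤
      (avSet (skewSum α β) (m + n)).ncard := by
  rw [← Set.ncard_prod]
  refine Set.ncard_le_ncard_of_injOn
    (fun x => shuffleMerge x.1 x.2 finSumFinEquiv finSumFinEquiv)
    (fun x hx => shuffleMerge_mem_avSet ha hb hx.1 hx.2) (fun x _ y _ hxy => ?_) (Set.toFinite _)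
  obtain ⟨h1, h2, -⟩ := shuffleMerge_inj_left (isShuffle_finSumFinEquiv m n)
    (isShuffle_finSumFinEquiv m n) hxy
  exact Prod.ext h1 h2

/-- Classes avoiding a skew-decomposable permutation have proper growth rates. -/
theorem exists_growth_avSet_skewSum {a b : ℕ} (ha : 0 < a) (hb : 0 < b)
    (α : Perm a) (β : Perm b) :
    ∃ g : ℝ, 1 ≤ g ∧ HasGrowth (avSet (skewSum α β)) g ∧
      ∀ n, ((avSet (skewSum α β) n).ncard : ℝ) ≤ g ^ n := by
  obtain ⟨K, hK⟩ := exists_ncard_avSet_le (Nat.add_pos_left ha b) (skewSum α β)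
  exact exists_growth_of_supermultiplicative
    (fun n => (Set.ncard_pos (Set.toFinite _)).2 ⟨1, one_mem_avSet_skewSum ha hb α β n⟩)
    (ncard_avSet_skewSum_mul_le ha hb α β) hK

/-! ### The upper bound -/

theorem ncard_shuffles_le (k l n : ℕ) :
    {e : Fin k ⊕ Fin l ≃ Fin n | IsShuffle e}.ncard ≤ n.choose k := by
  have h := Set.ncard_le_ncard_of_injOn (s := {e : Fin k ⊕ Fin l ≃ Fin n | IsShuffle e})
    (t := (Finset.powersetCard k (Finset.univ : Finset (Fin n)) : Set (Finset (Fin n))))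
    (fun e => Finset.univ.image fun i => e (Sum.inl i)) (fun e he => ?_)
    (fun e he e' he' h => ?_) (Set.toFinite _)
  · simpa [Set.ncard_coe_finset] using h
  · simp [Finset.mem_powersetCard, Finset.card_image_of_injective _ he.inl.injective]
  · refine he.eq_of_range_eq he' ?_
    have := congrArg (fun s : Finset (Fin n) => (s : Set (Fin n))) h
    simpa using this

theorem isShuffle_finSumEquivOfFinset {k l n : ℕ} {s : Finset (Fin n)} (hk : s.card = k)
    (hl : sᶜ.card = l) : IsShuffle (finSumEquivOfFinset hk hl) :=
  ⟨fun i j h => by simpa using h, fun i j h => by simpa using h⟩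

theorem range_finSumEquivOfFinset_inl {k l n : ℕ} {s : Finset (Fin n)} (hk : s.card = k)
    (hl : sᶜ.card = l) :
    Set.range (fun i => finSumEquivOfFinset hk hl (Sum.inl i)) = s := by
  simp only [finSumEquivOfFinset_inl]
  exact Finset.range_orderEmbOfFin _ _

/-- A permutation mapping the first part of one shuffle to the first part of another one is a
merge. -/
theorem exists_eq_shuffleMerge {k l n : ℕ} (ρ : Perm n) (e f : Fin k ⊕ Fin l ≃ Fin n)
    (h : ∀ i, ∃ j, ρ (e (Sum.inl i)) = f (Sum.inl j)) :
    ∃ π σ, ρ = shuffleMerge π σ e f := by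
  obtain ⟨⟨π, σ⟩, hπσ⟩ := Equiv.Perm.mem_sumCongrHom_range_of_perm_mapsTo_inl
    (σ := (e.trans ρ).trans f.symm) (by
      rintro _ ⟨i, rfl⟩
      obtain ⟨j, hj⟩ := h i
      exact ⟨j, by simp [hj]⟩)
  refine ⟨π, σ, Equiv.ext fun x => ?_⟩
  obtain ⟨y, rfl⟩ := e.surjective x
  have := Equiv.congr_fun hπσ y
  simp only [Equiv.Perm.sumCongrHom_apply, Equiv.trans_apply] at this
  simp only [shuffleMerge, Equiv.trans_apply, Equiv.symm_apply_apply]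
  rw [Equiv.eq_symm_apply] at this
  exact this.symm

/-- A permutation avoiding `α ⊖ 1 ⊖ γ` is a merge of a permutation avoiding `α ⊖ 1` with one
avoiding `1 ⊖ γ`. -/
theorem exists_shuffleMerge_of_avoids {a c n : ℕ} {α : Perm a} {γ : Perm c} {ρ : Perm n}
    (hρ : ρ ∈ avSet (skewSum α (skewSum one1 γ)) n) :
    ∃ k ≤ n, ∃ π ∈ avSet (skewSum α one1) k, ∃ σ ∈ avSet (skewSum one1 γ) (n - k),
      ∃ e f : Fin k ⊕ Fin (n - k) ≃ Fin n, IsShuffle e ∧ IsShuffle f ∧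
        shuffleMerge π σ e f = ρ := by
  classical
  let s : Finset (Fin n) :=
    Finset.univ.filter fun x => ∃ g, Occ γ ρ g ∧ ∀ j, x < g j ∧ ρ (g j) < ρ x
  have hk : s.card ≤ n := by simpa using s.card_le_univ
  have hsc : sᶜ.card = n - s.card := by rw [Finset.card_compl, Fintype.card_fin]
  let t := s.image ρ
  have ht : t.card = s.card := Finset.card_image_of_injective _ ρ.injective
  have htc : tᶜ.card = n - s.card := by rw [Finset.card_compl, Fintype.card_fin, ht]
  let e := finSumEquivOfFinset (rfl : s.card = s.card) hsc
  let f := finSumEquivOfFinset ht htc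
  have he : IsShuffle e := isShuffle_finSumEquivOfFinset _ _
  have hf : IsShuffle f := isShuffle_finSumEquivOfFinset _ _
  have hes : ∀ i, e (Sum.inl i) ∈ s := fun i => by
    rw [← Finset.mem_coe, ← range_finSumEquivOfFinset_inl (rfl : s.card = s.card) hsc]
    exact ⟨i, rfl⟩
  have hec : ∀ j, e (Sum.inr j) ∉ s := fun j hj => by
    rw [← Finset.mem_coe, ← range_finSumEquivOfFinset_inl (rfl : s.card = s.card) hsc] at hj
    obtain ⟨i, hi⟩ := hj
    simpa using e.injective hi
  obtain ⟨π, σ, hρ'⟩ := exists_eq_shuffleMerge ρ e f (fun i => by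
    have h1 : ρ (e (Sum.inl i)) ∈ (t : Set (Fin n)) := Finset.mem_image_of_mem _ (hes i)
    rw [← range_finSumEquivOfFinset_inl ht htc] at h1
    obtain ⟨j, hj⟩ := h1
    exact ⟨j, hj.symm⟩)
  refine ⟨s.card, hk, π, fun h => ?_, σ, fun h => ?_, e, f, he, hf, hρ'.symm⟩
  · obtain ⟨h, x, hh, hx⟩ := pattern_skewSum_one1_iff.1 h
    obtain ⟨g, hg, hxg⟩ := (Finset.mem_filter.1 (hes x)).2
    refine hρ (pattern_triple_iff.2 ⟨fun i => e (Sum.inl (h i)), e (Sum.inl x), g, ?_, hg,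
      fun i => ⟨he.inl (hx i).1, ?_⟩, hxg⟩)
    · rw [hρ']
      exact (occ_shuffleMerge_inl he hf).2 hh
    · rw [hρ']
      exact (shuffleMerge_inl_lt_inl hf).2 (hx i).2
  · obtain ⟨x, h, hh, hx⟩ := pattern_one1_skewSum_iff.1 h
    refine hec x (Finset.mem_filter.2 ⟨Finset.mem_univ _, fun j => e (Sum.inr (h j)), ?_,
      fun j => ⟨he.inr (hx j).1, ?_⟩⟩)
    · rw [hρ']
      exact (occ_shuffleMerge_inr he hf).2 hh
    · rw [hρ']
      exact (shuffleMerge_inr_lt_inr hf).2 (hx j).2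

theorem ncard_avSet_triple_le {a c : ℕ} (α : Perm a) (γ : Perm c) (n : ℕ) :
    (avSet (skewSum α (skewSum one1 γ)) n).ncard ≤ ∑ k ∈ Finset.range (n + 1), n.choose k ^ 2 *
      ((avSet (skewSum α one1) k).ncard * (avSet (skewSum one1 γ) (n - k)).ncard) := by
  let S : ∀ k, Set (Fin k ⊕ Fin (n - k) ≃ Fin n) := fun k => {e | IsShuffle e}
  let P : ∀ k, Set ((Perm k × Perm (n - k)) ×
      ((Fin k ⊕ Fin (n - k) ≃ Fin n) × (Fin k ⊕ Fin (n - k) ≃ Fin n))) := fun k =>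
    (avSet (skewSum α one1) k ×ˢ avSet (skewSum one1 γ) (n - k)) ×ˢ (S k ×ˢ S k)
  have hsub : avSet (skewSum α (skewSum one1 γ)) n ⊆ ⋃ k ∈ Finset.range (n + 1),
      (fun x => shuffleMerge x.1.1 x.1.2 x.2.1 x.2.2) '' P k := by
    intro ρ hρ
    obtain ⟨k, hk, π, hπ, σ, hσ, e, f, he, hf, h⟩ := exists_shuffleMerge_of_avoids hρ
    simp only [Set.mem_iUnion]
    exact ⟨k, Finset.mem_range.2 (by omega), ((π, σ), (e, f)), ⟨⟨hπ, hσ⟩, ⟨he, hf⟩⟩, h⟩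
  refine (Set.ncard_le_ncard hsub (Set.toFinite _)).trans
    ((Finset.set_ncard_biUnion_le _ _).trans (Finset.sum_le_sum fun k _ => ?_))
  refine (Set.ncard_image_le (Set.toFinite _)).trans ?_
  have hS : (S k).ncard ≤ n.choose k := ncard_shuffles_le k (n - k) n
  rw [Set.ncard_prod, Set.ncard_prod, Set.ncard_prod, mul_comm, sq]
  gcongr

/-! ### The lower bound -/

/-- Shuffles in which only the last `q` entries of the first part are interleaved with the
second part. -/
def tailShuffles (n p q : ℕ) : Set (Fin n ⊕ Fin p ≃ Fin (n + p)) :=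
  {e | IsShuffle e ∧ ∀ (i : Fin n) (j : Fin p), (i : ℕ) + q < n → e (Sum.inl i) < e (Sum.inr j)}

theorem choose_le_ncard_tailShuffles {n p q : ℕ} (hq : q ≤ n) :
    (p + q).choose p ≤ (tailShuffles n p q).ncard := by
  classical
  let U : Finset (Fin (n + p)) := Finset.univ.filter fun x => n ≤ (x : ℕ) + q
  have hU : U.card = p + q := by
    have h1 : U = (Finset.univ.filter fun x : Fin (n + p) => (x : ℕ) < n - q)ᶜ := by
      ext x
      simp only [U, Finset.mem_filter, Finset.mem_univ, true_and, Finset.mem_compl]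
      omega
    rw [h1, Finset.card_compl, Fintype.card_fin, Fin.card_filter_val_lt]
    omega
  have hcard : ∀ s ∈ Finset.powersetCard p U, sᶜ.card = n ∧ sᶜᶜ.card = p := fun s hs => by
    have h1 := (Finset.mem_powersetCard.1 hs).2
    rw [compl_compl, Finset.card_compl, Fintype.card_fin, h1]
    omega
  have key := Set.ncard_le_ncard_of_injOn
    (s := (Finset.powersetCard p U : Set (Finset (Fin (n + p))))) (t := tailShuffles n p q)
    (fun s => if hs : s ∈ Finset.powersetCard p U then
      finSumEquivOfFinset (hcard s hs).1 (hcard s hs).2 else finSumFinEquiv)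
    (fun s hs => ?_) (fun s hs s' hs' h => ?_) (Set.toFinite _)
  · rwa [Set.ncard_coe_finset, Finset.card_powersetCard, hU] at key
  · rw [Finset.mem_coe] at hs
    rw [dif_pos hs]
    set e := finSumEquivOfFinset (hcard s hs).1 (hcard s hs).2 with he
    have hsh : IsShuffle e := isShuffle_finSumEquivOfFinset _ _
    have hmem : ∀ j, e (Sum.inr j) ∈ s := fun j => by
      have : e (Sum.inr j) ∈ sᶜᶜ := Finset.orderEmbOfFin_mem _ (hcard s hs).2 j
      rwa [compl_compl] at this
    have hsurj : ∀ x ∉ s, ∃ i, e (Sum.inl i) = x := fun x hx => by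
      obtain ⟨y | y, rfl⟩ := e.surjective x
      · exact ⟨y, rfl⟩
      · exact absurd (hmem y) hx
    refine ⟨hsh, fun i j hi => ?_⟩
    have hj := (Finset.mem_filter.1 ((Finset.mem_powersetCard.1 hs).1 (hmem j))).2
    by_contra! hle
    have hsub : (Finset.univ.filter fun x : Fin (n + p) => (x : ℕ) < n - q) ⊆
        (Finset.Iio i).image fun i => e (Sum.inl i) := by
      intro x hx
      have hx := (Finset.mem_filter.1 hx).2
      obtain ⟨y, rfl⟩ := hsurj x fun hxs => by
        have := (Finset.mem_filter.1 ((Finset.mem_powersetCard.1 hs).1 hxs)).2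
        omega
      refine Finset.mem_image_of_mem _ (Finset.mem_Iio.2 (hsh.inl.lt_iff_lt.1 ?_))
      rw [Fin.lt_def]
      rw [Fin.le_def] at hle
      omega
    have h1 := (Finset.card_le_card hsub).trans Finset.card_image_le
    rw [Fin.card_filter_val_lt, Fin.card_Iio] at h1
    omega
  · rw [Finset.mem_coe] at hs hs'
    simp only [dif_pos hs, dif_pos hs'] at h
    have h1 := range_finSumEquivOfFinset_inl (hcard s hs).1 (hcard s hs).2
    rw [h, range_finSumEquivOfFinset_inl] at h1
    exact (compl_injective (Finset.coe_injective h1)).symm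

section

variable {a c : ℕ} (α : Perm a) (γ : Perm c)

/-- Permutations avoiding `α ⊖ 1 ⊖ γ` in which no occurrence of `1 ⊖ γ` starts in the last `q`
positions. -/
def avTailPositions (n q : ℕ) : Set (Perm n) :=
  {π | π ∈ avSet (skewSum α (skewSum one1 γ)) n ∧ ∀ x g, Occ γ π g →
    (∀ j, x < g j ∧ π (g j) < π x) → (x : ℕ) + q < n}

/-- Permutations avoiding `α ⊖ 1 ⊖ γ` in which no occurrence of `α ⊖ 1` ends in one of the `p`
largest values. -/
def avTailValues (n p : ℕ) : Set (Perm n) :=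
  {π | π ∈ avSet (skewSum α (skewSum one1 γ)) n ∧ ∀ f x, Occ α π f →
    (∀ i, f i < x ∧ π x < π (f i)) → (π x : ℕ) + p < n}

variable {α γ}

theorem shuffleMerge_mem_avTailValues {n p q : ℕ} {π : Perm n} {σ : Perm p}
    {e : Fin n ⊕ Fin p ≃ Fin (n + p)} (hπ : π ∈ avTailPositions α γ n q)
    (hσ : σ ∈ avSet (skewSum α one1) p) (he : e ∈ tailShuffles n p q) :
    shuffleMerge π σ e finSumFinEquiv ∈ avTailValues α γ (n + p) p := by
  have hs := isShuffle_finSumFinEquiv n p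
  have hinr : ∀ f y, Occ α (shuffleMerge π σ e finSumFinEquiv) f →
      ¬ ∀ i, f i < e (Sum.inr y) ∧ shuffleMerge π σ e finSumFinEquiv (e (Sum.inr y)) <
        shuffleMerge π σ e finSumFinEquiv (f i) := by
    intro f y hf hfx
    obtain ⟨f, rfl⟩ := exists_eq_inr_of_forall_ne e (h := f) fun i =>
      ne_inl_of_lt_shuffleMerge (fun i => finSumFinEquiv_inl_lt_inr i _) (hfx i).2
    exact hσ (pattern_skewSum_one1_iff.2 ⟨f, y, (occ_shuffleMerge_inr he.1 hs).1 hf, fun i =>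
      ⟨he.1.inr.lt_iff_lt.1 (hfx i).1, (shuffleMerge_inr_lt_inr hs).1 (hfx i).2⟩⟩)
  refine ⟨fun h => ?_, fun f x hf hfx => ?_⟩
  · obtain ⟨f, x, g, hf, hg, hfx, hxg⟩ := pattern_triple_iff.1 h
    obtain ⟨y | y, rfl⟩ := e.surjective x
    · obtain ⟨g, rfl⟩ := exists_eq_inl_of_forall_ne e (h := g) fun j =>
        ne_inr_of_shuffleMerge_lt (finSumFinEquiv_inl_lt_inr _) (hxg j).2
      have hg' := (occ_shuffleMerge_inl he.1 hs).1 hg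
      have hxg' : ∀ j, y < g j ∧ π (g j) < π y := fun j =>
        ⟨he.1.inl.lt_iff_lt.1 (hxg j).1, (shuffleMerge_inl_lt_inl hs).1 (hxg j).2⟩
      have hy := hπ.2 y g hg' hxg'
      obtain ⟨f, rfl⟩ := exists_eq_inl_of_forall_ne e (h := f) fun i =>
        ne_inr_of_lt_inl (fun j => he.2 y j hy) (hfx i).1
      exact hπ.1 (pattern_triple_iff.2 ⟨f, y, g, (occ_shuffleMerge_inl he.1 hs).1 hf, hg',
        fun i => ⟨he.1.inl.lt_iff_lt.1 (hfx i).1, (shuffleMerge_inl_lt_inl hs).1 (hfx i).2⟩,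
        hxg'⟩)
    · exact hinr f y hf hfx
  · obtain ⟨y | y, rfl⟩ := e.surjective x
    · rw [shuffleMerge_inl, finSumFinEquiv_apply_left, Fin.val_castAdd]
      omega
    · exact absurd hfx (hinr f y hf)

theorem shuffleMerge_mem_avTailPositions {n p q : ℕ} {π : Perm n} {σ : Perm q}
    {f : Fin n ⊕ Fin q ≃ Fin (n + q)} (hπ : π ∈ avTailValues α γ n p)
    (hσ : σ ∈ avSet (skewSum one1 γ) q) (hf : f ∈ tailShuffles n q p) :
    shuffleMerge π σ finSumFinEquiv f ∈ avTailPositions α γ (n + q) q := by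
  have hs := isShuffle_finSumFinEquiv n q
  have hinr : ∀ y g, Occ γ (shuffleMerge π σ finSumFinEquiv f) g →
      ¬ ∀ j, finSumFinEquiv (Sum.inr y) < g j ∧ shuffleMerge π σ finSumFinEquiv f (g j) <
        shuffleMerge π σ finSumFinEquiv f (finSumFinEquiv (Sum.inr y)) := by
    intro y g hg hxg
    obtain ⟨g, rfl⟩ := exists_eq_inr_of_forall_ne finSumFinEquiv (h := g) fun j =>
      ne_inl_of_inr_lt (fun i => finSumFinEquiv_inl_lt_inr i _) (hxg j).1
    exact hσ (pattern_one1_skewSum_iff.2 ⟨y, g, (occ_shuffleMerge_inr hs hf.1).1 hg, fun j =>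
      ⟨hs.inr.lt_iff_lt.1 (hxg j).1, (shuffleMerge_inr_lt_inr hf.1).1 (hxg j).2⟩⟩)
  refine ⟨fun h => ?_, fun x g hg hxg => ?_⟩
  · obtain ⟨h, x, g, hh, hg, hhx, hxg⟩ := pattern_triple_iff.1 h
    obtain ⟨y | y, rfl⟩ := (finSumFinEquiv : Fin n ⊕ Fin q ≃ _).surjective x
    · obtain ⟨h, rfl⟩ := exists_eq_inl_of_forall_ne finSumFinEquiv (h := h) fun i =>
        ne_inr_of_lt_inl (finSumFinEquiv_inl_lt_inr _) (hhx i).1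
      have hh' := (occ_shuffleMerge_inl hs hf.1).1 hh
      have hhx' : ∀ i, h i < y ∧ π y < π (h i) := fun i =>
        ⟨hs.inl.lt_iff_lt.1 (hhx i).1, (shuffleMerge_inl_lt_inl hf.1).1 (hhx i).2⟩
      have hy := hπ.2 h y hh' hhx'
      obtain ⟨g, rfl⟩ := exists_eq_inl_of_forall_ne finSumFinEquiv (h := g) fun j =>
        ne_inr_of_shuffleMerge_lt (fun j => hf.2 (π y) j hy) (hxg j).2
      exact hπ.1 (pattern_triple_iff.2 ⟨h, y, g, hh', (occ_shuffleMerge_inl hs hf.1).1 hg, hhx',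
        fun j => ⟨hs.inl.lt_iff_lt.1 (hxg j).1, (shuffleMerge_inl_lt_inl hf.1).1 (hxg j).2⟩⟩)
    · exact hinr y g hg hxg
  · obtain ⟨y | y, rfl⟩ := (finSumFinEquiv : Fin n ⊕ Fin q ≃ _).surjective x
    · rw [finSumFinEquiv_apply_left, Fin.val_castAdd]
      omega
    · exact absurd hxg (hinr y g hg)

theorem ncard_avTailPositions_mul_le {n p q : ℕ} (hq : q ≤ n) :
    (avTailPositions α γ n q).ncard * ((avSet (skewSum α one1) p).ncard * (p + q).choose p) ≤
      (avTailValues α γ (n + p) p).ncard := by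
  refine (Nat.mul_le_mul_left _ (Nat.mul_le_mul_left _ (choose_le_ncard_tailShuffles hq))).trans ?_
  rw [← Set.ncard_prod, ← Set.ncard_prod]
  refine Set.ncard_le_ncard_of_injOn (fun x => shuffleMerge x.1 x.2.1 x.2.2 finSumFinEquiv)
    (fun x hx => shuffleMerge_mem_avTailValues hx.1 hx.2.1 hx.2.2) (fun x hx y hy hxy => ?_)
    (Set.toFinite _)
  obtain ⟨h1, h2, h3⟩ := shuffleMerge_inj_left hx.2.2.1 hy.2.2.1 hxy
  exact Prod.ext h1 (Prod.ext h2 h3)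

theorem ncard_avTailValues_mul_le {n p q : ℕ} (hp : p ≤ n) :
    (avTailValues α γ n p).ncard * ((avSet (skewSum one1 γ) q).ncard * (p + q).choose p) ≤
      (avTailPositions α γ (n + q) q).ncard := by
  have h := choose_le_ncard_tailShuffles (p := q) hp
  rw [Nat.choose_symm_add, add_comm] at h
  refine (Nat.mul_le_mul_left _ (Nat.mul_le_mul_left _ h)).trans ?_
  rw [← Set.ncard_prod, ← Set.ncard_prod]
  refine Set.ncard_le_ncard_of_injOn (fun x => shuffleMerge x.1 x.2.1 finSumFinEquiv x.2.2)
    (fun x hx => shuffleMerge_mem_avTailPositions hx.1 hx.2.1 hx.2.2) (fun x hx y hy hxy => ?_)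
    (Set.toFinite _)
  obtain ⟨h1, h2, h3⟩ := shuffleMerge_inj_right hx.2.2.1 hy.2.2.1 hxy
  exact Prod.ext h1 (Prod.ext h2 h3)

theorem pow_le_ncard_avTailPositions (ha : 0 < a) (hc : 0 < c) (p q t : ℕ) :
    ((avSet (skewSum α one1) p).ncard * (avSet (skewSum one1 γ) q).ncard *
      (p + q).choose p ^ 2) ^ t ≤ (avTailPositions α γ (q + t * (p + q)) q).ncard := by
  induction t with
  | zero =>
    rw [pow_zero, Order.one_le_iff_pos, Set.ncard_pos (Set.toFinite _)]
    refine ⟨1, one_mem_avSet_skewSum ha (by omega) _ _ _, fun x g _ h => ?_⟩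
    exact absurd (h ⟨0, hc⟩).1 (h ⟨0, hc⟩).2.not_gt
  | succ t ih =>
    have h1 := ncard_avTailPositions_mul_le (α := α) (γ := γ) (p := p)
      (Nat.le_add_right q (t * (p + q)))
    have h2 := ncard_avTailValues_mul_le (α := α) (γ := γ) (q := q)
      (Nat.le_add_left p (q + t * (p + q)))
    rw [show q + (t + 1) * (p + q) = q + t * (p + q) + p + q by ring]
    refine le_trans ?_ h2
    refine le_trans ?_ (Nat.mul_le_mul_right _ ((Nat.mul_le_mul_right _ ih).trans h1))
    rw [pow_succ]
    exact le_of_eq (by ring)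

end

/-- For all nonempty permutations `α` and `γ`, the classes `Av(α ⊖ 1)`,
`Av(1 ⊖ γ)` and `Av(α ⊖ 1 ⊖ γ)` have finite proper growth rates, and
`gr(Av(α ⊖ 1 ⊖ γ)) = (√gr(Av(α ⊖ 1)) + √gr(Av(1 ⊖ γ)))²`. -/
theorem bona_triple_skew_growth {a c : ℕ} (ha : 0 < a) (hc : 0 < c)
    (α : Perm a) (γ : Perm c) :
    ∃ g₁ g₂ : ℝ, HasGrowth (avSet (skewSum α one1)) g₁ ∧
      HasGrowth (avSet (skewSum one1 γ)) g₂ ∧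
      HasGrowth (avSet (skewSum α (skewSum one1 γ)))
        ((Real.sqrt g₁ + Real.sqrt g₂) ^ 2) := by
  obtain ⟨g₁, hg₁, h₁, h₁'⟩ := exists_growth_avSet_skewSum ha one_pos α one1
  obtain ⟨g₂, hg₂, h₂, h₂'⟩ := exists_growth_avSet_skewSum one_pos hc one1 γ
  obtain ⟨g₃, hg₃, h₃, h₃'⟩ :=
    exists_growth_avSet_skewSum ha (Nat.add_pos_left one_pos c) α (skewSum one1 γ)
  refine ⟨g₁, g₂, h₁, h₂, ?_⟩
  rwa [← growth_eq_sq_sqrt_add_sqrt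
    (fun n => (Set.ncard_pos (Set.toFinite _)).2 ⟨1, one_mem_avSet_skewSum ha one_pos α one1 n⟩)
    (fun n => (Set.ncard_pos (Set.toFinite _)).2 ⟨1, one_mem_avSet_skewSum one_pos hc one1 γ n⟩)
    hg₁ hg₂ hg₃ h₁ h₂ h₃ h₁' h₂' h₃' (ncard_avSet_triple_le α γ)
    (fun p q t => (pow_le_ncard_avTailPositions ha hc p q t).trans
      (Set.ncard_le_ncard (fun _ h => h.1) (Set.toFinite _)))]
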